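/- Let ρ : G → GL_n(ℂ) be a nontrivial irreducible unitary complex representation of a finite group G such that the underlying real representation on ℝ^{2n} is irreducible with End_G ≅ ℂ (complex type). Let M ∈ Mat_{n×m}(ℂ) with ∑_{s,i}|M_{si}|² = 1. Then the real orbit {ρ(g)M : g ∈ G} ⊂ Mat_{n×m}(ℂ) ≅ ℝ^{2nm} (with the real part of the Hermitian Frobenius inner product) is a spherical 2-design if and only if M*M = (1/m)·I_m, where M* is the conjugate transpose. -/

import Mathlib

open Matrix

theorem aux_S1 {G : Type*} [Group G] [Fintype G] {n : ℕ}
    (ρ : G →* Matrix.unitaryGroup (Fin n) ℂ)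
    (hC : ∀ T : (Fin n → ℂ) →ₗ[ℝ] (Fin n → ℂ),
      (∀ (g : G) (w : Fin n → ℂ),
        T ((ρ g : Matrix (Fin n) (Fin n) ℂ).mulVec w)
          = (ρ g : Matrix (Fin n) (Fin n) ℂ).mulVec (T w)) →
      ∃ c : ℂ, ∀ w : Fin n → ℂ, T w = c • w)
    (Y : Matrix (Fin n) (Fin n) ℂ)
    (hY : ∀ g, Y * (ρ g : Matrix (Fin n) (Fin n) ℂ) = (ρ g : Matrix (Fin n) (Fin n) ℂ) * Y) :
    ∃ c : ℂ, Y = c • (1 : Matrix (Fin n) (Fin n) ℂ) := by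
  obtain ⟨c, hc⟩ := hC ((Matrix.mulVecLin Y).restrictScalars ℝ) (by
    intro g w
    simp [Matrix.mulVec_mulVec, hY])
  refine ⟨c, ?_⟩
  apply Matrix.ext_of_mulVec_single
  intro i
  have := hc (Pi.single i 1)
  rw [Matrix.smul_mulVec, Matrix.one_mulVec]
  exact this

theorem aux_unit {n : ℕ} (U : Matrix.unitaryGroup (Fin n) ℂ) :
    (U : Matrix (Fin n) (Fin n) ℂ)ᴴ * (U : Matrix (Fin n) (Fin n) ℂ) = 1 := by
  have := Matrix.mem_unitaryGroup_iff'.1 U.2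
  simpa [Matrix.star_eq_conjTranspose] using this

theorem aux_avg {G : Type*} [Group G] [Fintype G] {n : ℕ}
    (ρ : G →* Matrix.unitaryGroup (Fin n) ℂ)
    (hC : ∀ T : (Fin n → ℂ) →ₗ[ℝ] (Fin n → ℂ),
      (∀ (g : G) (w : Fin n → ℂ),
        T ((ρ g : Matrix (Fin n) (Fin n) ℂ).mulVec w)
          = (ρ g : Matrix (Fin n) (Fin n) ℂ).mulVec (T w)) →
      ∃ c : ℂ, ∀ w : Fin n → ℂ, T w = c • w)
    (hn : n ≠ 0) (X : Matrix (Fin n) (Fin n) ℂ) :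
    ∑ g : G, (ρ g : Matrix (Fin n) (Fin n) ℂ) * X * (ρ g : Matrix (Fin n) (Fin n) ℂ)ᴴ
      = ((Fintype.card G : ℂ) * X.trace / n) • (1 : Matrix (Fin n) (Fin n) ℂ) := by
  obtain ⟨c, hc⟩ := aux_S1 ρ hC
    (∑ g : G, (ρ g : Matrix (Fin n) (Fin n) ℂ) * X * (ρ g : Matrix (Fin n) (Fin n) ℂ)ᴴ) (by
    intro h
    rw [Finset.sum_mul, Finset.mul_sum]
    refine (Fintype.sum_equiv (Equiv.mulLeft h) _ _ ?_).symm
    intro g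
    simp only [Equiv.coe_mulLeft, map_mul, Submonoid.coe_mul, Matrix.conjTranspose_mul]
    simp only [Matrix.mul_assoc, aux_unit, Matrix.mul_one])
  have ht := congrArg Matrix.trace hc
  rw [Matrix.trace_sum] at ht
  have h1 : ∀ g : G, ((ρ g : Matrix (Fin n) (Fin n) ℂ) * X *
      (ρ g : Matrix (Fin n) (Fin n) ℂ)ᴴ).trace = X.trace := by
    intro g
    rw [Matrix.trace_mul_comm, ← Matrix.mul_assoc, aux_unit, Matrix.one_mul]
  simp [h1] at ht
  have hn' : (n : ℂ) ≠ 0 := by exact_mod_cast hn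
  rw [hc, ht, mul_div_assoc, div_self hn', mul_one]

theorem aux_anti {G : Type*} [Group G] [Fintype G] {n : ℕ}
    (ρ : G →* Matrix.unitaryGroup (Fin n) ℂ)
    (hC : ∀ T : (Fin n → ℂ) →ₗ[ℝ] (Fin n → ℂ),
      (∀ (g : G) (w : Fin n → ℂ),
        T ((ρ g : Matrix (Fin n) (Fin n) ℂ).mulVec w)
          = (ρ g : Matrix (Fin n) (Fin n) ℂ).mulVec (T w)) →
      ∃ c : ℂ, ∀ w : Fin n → ℂ, T w = c • w)
    (X : Matrix (Fin n) (Fin n) ℂ) :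
    ∑ g : G, (ρ g : Matrix (Fin n) (Fin n) ℂ) * X * (ρ g : Matrix (Fin n) (Fin n) ℂ)ᵀ = 0 := by
  set Y := ∑ g : G, (ρ g : Matrix (Fin n) (Fin n) ℂ) * X *
    (ρ g : Matrix (Fin n) (Fin n) ℂ)ᵀ with hYd
  have hY : ∀ h : G, Y * ((ρ h : Matrix (Fin n) (Fin n) ℂ).map star)
      = (ρ h : Matrix (Fin n) (Fin n) ℂ) * Y := by
    intro h
    rw [hYd, Finset.sum_mul, Finset.mul_sum]
    refine (Fintype.sum_equiv (Equiv.mulLeft h) _ _ ?_).symm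
    intro g
    have hu : (ρ h : Matrix (Fin n) (Fin n) ℂ)ᵀ * (ρ h : Matrix (Fin n) (Fin n) ℂ).map star
        = 1 := by
      have := congrArg Matrix.transpose (aux_unit (ρ h))
      rw [Matrix.transpose_mul, Matrix.transpose_one] at this
      exact this
    simp only [Equiv.coe_mulLeft, map_mul, Submonoid.coe_mul, Matrix.transpose_mul]
    simp only [Matrix.mul_assoc, hu, Matrix.mul_one]
  let T : (Fin n → ℂ) →ₗ[ℝ] (Fin n → ℂ) :=
    { toFun := fun w => Y *ᵥ (star w)
      map_add' := by intro a b; simp [Matrix.mulVec_add]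
      map_smul' := by intro a b; simp [Matrix.mulVec_smul] }
  obtain ⟨c, hc⟩ := hC T (by
    intro g w
    change Y *ᵥ star (_ *ᵥ w) = _ *ᵥ (Y *ᵥ star w)
    rw [Matrix.mulVec_mulVec, ← hY, ← Matrix.mulVec_mulVec]
    congr 1
    ext i
    simp [Matrix.mulVec, dotProduct])
  have hc' : ∀ w : Fin n → ℂ, Y *ᵥ star w = c • w := hc
  apply Matrix.ext_of_mulVec_single
  intro i
  have h1 := hc' (Pi.single i 1)
  have h2 := hc' (Complex.I • Pi.single i 1)
  rw [star_smul, Matrix.mulVec_smul, h1] at h2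
  have h3 := congrFun h2 i
  simp at h3
  have hc0 : c = 0 := by
    have : Complex.I * c = 0 := by linear_combination (-1/2 : ℂ) * h3
    simpa using this
  rw [hc0] at h1
  have hs : star (Pi.single i 1 : Fin n → ℂ) = Pi.single i 1 := by
    ext j
    by_cases h : j = i
    · subst h; simp
    · simp [h]
  rw [hs] at h1
  rw [h1, zero_smul, Matrix.zero_mulVec]

theorem aux_tr {n : ℕ} (P Q R S : Matrix (Fin n) (Fin n) ℂ) :
    (P * R).trace * (S * Q).trace =
      ∑ k, ∑ s, ∑ l, ∑ t, P k s * Q t l * (R * Matrix.single k l (1 : ℂ) * S : Matrix (Fin n) (Fin n) ℂ) s t := by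
  have h : ∀ k l s t, (R * Matrix.single k l (1:ℂ) * S) s t = R s k * S l t := by
    intro k l s t
    rw [Matrix.mul_assoc, Matrix.mul_apply, Finset.sum_eq_single k]
    · simp
    · intro b _ hb
      rw [Matrix.single_mul_apply_of_ne]
      · simp
      · exact hb
    · simp
  simp only [h, Matrix.trace, Matrix.diag, Matrix.mul_apply]
  rw [Finset.sum_mul]
  refine Finset.sum_congr rfl fun k _ => ?_
  rw [Finset.sum_mul]
  refine Finset.sum_congr rfl fun s _ => ?_
  rw [Finset.mul_sum]
  refine Finset.sum_congr rfl fun l _ => ?_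
  rw [Finset.mul_sum]
  refine Finset.sum_congr rfl fun t _ => ?_
  ring

theorem aux_swap {G : Type*} [Fintype G] {n : ℕ} (P Q : Matrix (Fin n) (Fin n) ℂ)
    (R S : G → Matrix (Fin n) (Fin n) ℂ) :
    ∑ g, (P * R g).trace * (S g * Q).trace =
      ∑ k, ∑ s, ∑ l, ∑ t, P k s * Q t l *
        (∑ g, R g * Matrix.single k l (1 : ℂ) * S g : Matrix (Fin n) (Fin n) ℂ) s t := by
  simp only [aux_tr, Matrix.sum_apply, Finset.mul_sum]
  rw [Finset.sum_comm]
  refine Finset.sum_congr rfl fun k _ => ?_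
  rw [Finset.sum_comm]
  refine Finset.sum_congr rfl fun s _ => ?_
  rw [Finset.sum_comm]
  refine Finset.sum_congr rfl fun l _ => ?_
  rw [Finset.sum_comm]

theorem aux_moment {G : Type*} [Group G] [Fintype G] {n m : ℕ}
    (ρ : G →* Matrix.unitaryGroup (Fin n) ℂ)
    (hC : ∀ T : (Fin n → ℂ) →ₗ[ℝ] (Fin n → ℂ),
      (∀ (g : G) (w : Fin n → ℂ),
        T ((ρ g : Matrix (Fin n) (Fin n) ℂ).mulVec w)
          = (ρ g : Matrix (Fin n) (Fin n) ℂ).mulVec (T w)) →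
      ∃ c : ℂ, ∀ w : Fin n → ℂ, T w = c • w)
    (hn : n ≠ 0) (M A B : Matrix (Fin n) (Fin m) ℂ) :
    (Fintype.card G : ℝ)⁻¹ * ∑ g : G,
         (Matrix.trace (((ρ g : Matrix (Fin n) (Fin n) ℂ) * M)ᴴ * A)).re *
           (Matrix.trace (((ρ g : Matrix (Fin n) (Fin n) ℂ) * M)ᴴ * B)).re
      = (2 * n : ℝ)⁻¹ * (Matrix.trace (Aᴴ * B * (Mᴴ * M))).re := by
  have key1 : ∑ g : G, ((M * Aᴴ) * (ρ g : Matrix (Fin n) (Fin n) ℂ)).trace *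
      ((ρ g : Matrix (Fin n) (Fin n) ℂ)ᴴ * (B * Mᴴ)).trace
      = (Fintype.card G : ℂ) / n * (Matrix.trace (Aᴴ * B * (Mᴴ * M))) := by
    rw [aux_swap]
    simp only [aux_avg ρ hC hn]
    have : Matrix.trace (Aᴴ * B * (Mᴴ * M)) = ((M * Aᴴ) * (B * Mᴴ)).trace := by
      rw [← Matrix.mul_assoc, Matrix.trace_mul_comm]
      simp only [Matrix.mul_assoc]
    rw [this]
    generalize M * Aᴴ = P
    generalize B * Mᴴ = Q
    have ht : (P * Q).trace = ∑ k, ∑ s, P k s * Q s k := by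
      simp only [Matrix.trace, Matrix.diag, Matrix.mul_apply]
    rw [ht, Finset.mul_sum]
    refine Finset.sum_congr rfl fun k _ => ?_
    rw [Finset.mul_sum]
    refine Finset.sum_congr rfl fun s _ => ?_
    rw [Finset.sum_eq_single k, Finset.sum_eq_single s]
    · have : (Matrix.single k k (1:ℂ)).trace = 1 := by
        simp only [Matrix.trace, Matrix.diag]
        rw [Finset.sum_eq_single k] <;> simp +contextual [Matrix.single_apply, eq_comm]
      rw [this, Matrix.smul_apply, Matrix.one_apply_eq, smul_eq_mul]; ring
    · intro t _ ht
      simp [Matrix.one_apply, ht.symm]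
    · simp
    · intro l _ hl
      have : (Matrix.single k l (1:ℂ)).trace = 0 := by
        simp only [Matrix.trace, Matrix.diag]
        refine Finset.sum_eq_zero fun x _ => ?_
        rw [Matrix.single_apply, if_neg]
        rintro ⟨rfl, h⟩
        exact hl h
      simp only [this]; simp
    · simp
  have key2 : ∑ g : G, ((M * Aᴴ) * (ρ g : Matrix (Fin n) (Fin n) ℂ)).trace *
      ((ρ g : Matrix (Fin n) (Fin n) ℂ)ᵀ * (B * Mᴴ)ᴴᵀ).trace = 0 := by
    rw [aux_swap]
    simp only [aux_anti ρ hC]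
    simp
  have hre : ∀ g : G, (Matrix.trace (((ρ g : Matrix (Fin n) (Fin n) ℂ) * M)ᴴ * A)).re *
           (Matrix.trace (((ρ g : Matrix (Fin n) (Fin n) ℂ) * M)ᴴ * B)).re
      = 2⁻¹ * ((((M * Aᴴ) * (ρ g : Matrix (Fin n) (Fin n) ℂ)).trace *
      ((ρ g : Matrix (Fin n) (Fin n) ℂ)ᴴ * (B * Mᴴ)).trace).re +
      (((M * Aᴴ) * (ρ g : Matrix (Fin n) (Fin n) ℂ)).trace *
      ((ρ g : Matrix (Fin n) (Fin n) ℂ)ᵀ * (B * Mᴴ)ᴴᵀ).trace).re) := by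
    intro g
    generalize (ρ g : Matrix (Fin n) (Fin n) ℂ) = R
    have e1 : (M * Aᴴ * R).trace = star (((R * M)ᴴ * A).trace) := by
      rw [← Matrix.trace_conjTranspose]
      simp only [Matrix.conjTranspose_mul, Matrix.conjTranspose_conjTranspose]
      rw [Matrix.mul_assoc, Matrix.trace_mul_comm, Matrix.mul_assoc]
    have e2 : (Rᴴ * (B * Mᴴ)).trace = ((R * M)ᴴ * B).trace := by
      rw [Matrix.conjTranspose_mul, Matrix.mul_assoc, Matrix.trace_mul_comm Mᴴ, Matrix.mul_assoc]
    have e3 : (Rᵀ * (B * Mᴴ)ᴴᵀ).trace = star (((R * M)ᴴ * B).trace) := by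
      rw [← e2, ← Matrix.trace_conjTranspose, ← Matrix.transpose_mul, Matrix.trace_transpose,
        Matrix.conjTranspose_mul Rᴴ, Matrix.conjTranspose_conjTranspose]
    rw [e1, e2, e3]
    simp [Complex.mul_re]
    ring
  simp only [hre]
  rw [← Finset.mul_sum, Finset.sum_add_distrib, ← Complex.re_sum, ← Complex.re_sum, key1, key2]
  have hG : (Fintype.card G : ℝ) ≠ 0 := by
    exact_mod_cast Fintype.card_ne_zero
  have hn' : (n : ℝ) ≠ 0 := by exact_mod_cast hn
  have : ((Fintype.card G : ℂ) / n) = ((Fintype.card G / n : ℝ) : ℂ) := by push_cast; rfl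
  rw [this, Complex.re_ofReal_mul, Complex.zero_re]
  field_simp
  ring

/-- Let `ρ : G → U(n)` be a nontrivial irreducible unitary complex
representation whose underlying real representation on `ℝ^{2n}` is irreducible with
`End_G ≅ ℂ` (complex type), and let `M ∈ Mat_{n×m}(ℂ)` with `∑ |M_{si}|² = 1`. Then the
orbit `{ρ(g) M}` in `Mat_{n×m}(ℂ) ≅ ℝ^{2nm}` (with the real part of the Hermitian
Frobenius inner product) is a spherical 2-design iff `M* M = (1/m)·I_m`. -/
theorem stmt19 {G : Type*} [Group G] [Fintype G] {n m : ℕ}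
    (ρ : G →* Matrix.unitaryGroup (Fin n) ℂ)
    -- complex type: every ℝ-linear endomorphism commuting with the action is a complex scalar
    (hC : ∀ T : (Fin n → ℂ) →ₗ[ℝ] (Fin n → ℂ),
      (∀ (g : G) (w : Fin n → ℂ),
        T ((ρ g : Matrix (Fin n) (Fin n) ℂ).mulVec w)
          = (ρ g : Matrix (Fin n) (Fin n) ℂ).mulVec (T w)) →
      ∃ c : ℂ, ∀ w : Fin n → ℂ, T w = c • w)
    (hnontriv : ∃ g : G, (ρ g : Matrix (Fin n) (Fin n) ℂ) ≠ 1)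
    (M : Matrix (Fin n) (Fin m) ℂ)
    (hM : ∑ s : Fin n, ∑ i : Fin m, ‖M s i‖ ^ 2 = 1) :
    ((∑ g : G, (ρ g : Matrix (Fin n) (Fin n) ℂ) * M = 0) ∧
     (∀ A B : Matrix (Fin n) (Fin m) ℂ,
       (Fintype.card G : ℝ)⁻¹ * ∑ g : G,
         (Matrix.trace (((ρ g : Matrix (Fin n) (Fin n) ℂ) * M)ᴴ * A)).re *
           (Matrix.trace (((ρ g : Matrix (Fin n) (Fin n) ℂ) * M)ᴴ * B)).re
         = ((2 * n * m : ℕ) : ℝ)⁻¹ * (Matrix.trace (Aᴴ * B)).re))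
      ↔ Mᴴ * M = (m : ℝ)⁻¹ • (1 : Matrix (Fin m) (Fin m) ℂ) := by
  have hn : n ≠ 0 := by
    rintro rfl
    simp at hM
  have hm : m ≠ 0 := by
    rintro rfl
    simp at hM
  have hn' : (n : ℝ) ≠ 0 := by exact_mod_cast hn
  have hm' : (m : ℝ) ≠ 0 := by exact_mod_cast hm
  have hsum : ∑ g : G, (ρ g : Matrix (Fin n) (Fin n) ℂ) = 0 := by
    have hr : ∀ h : G, (∑ g : G, (ρ g : Matrix (Fin n) (Fin n) ℂ)) *
        (ρ h : Matrix (Fin n) (Fin n) ℂ) = ∑ g : G, (ρ g : Matrix (Fin n) (Fin n) ℂ) := by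
      intro h
      rw [Finset.sum_mul]
      exact Fintype.sum_equiv (Equiv.mulRight h) _ _ (by intro g; simp)
    have hl : ∀ h : G, (ρ h : Matrix (Fin n) (Fin n) ℂ) *
        (∑ g : G, (ρ g : Matrix (Fin n) (Fin n) ℂ)) =
        ∑ g : G, (ρ g : Matrix (Fin n) (Fin n) ℂ) := by
      intro h
      rw [Finset.mul_sum]
      exact Fintype.sum_equiv (Equiv.mulLeft h) _ _ (by intro g; simp)
    obtain ⟨c, hc⟩ := aux_S1 ρ hC _ (fun g => (hr g).trans (hl g).symm)
    obtain ⟨h, hh⟩ := hnontriv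
    have h1 := hr h
    rw [hc] at h1 ⊢
    rw [Matrix.smul_mul, Matrix.one_mul, ← sub_eq_zero, ← smul_sub, smul_eq_zero,
      sub_eq_zero] at h1
    rcases h1 with h1 | h1
    · simp [h1]
    · exact absurd h1 hh
  rw [← Matrix.sum_mul, hsum, Matrix.zero_mul]
  simp only [true_and, aux_moment ρ hC hn]
  constructor
  · intro h
    have h' : ∀ A B : Matrix (Fin n) (Fin m) ℂ,
        (Matrix.trace (Aᴴ * B * (Mᴴ * M - (m : ℝ)⁻¹ • (1 : Matrix (Fin m) (Fin m) ℂ)))).re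
          = 0 := by
      intro A B
      have := h A B
      rw [Matrix.mul_sub, Matrix.trace_sub, Matrix.mul_smul, Matrix.trace_smul, Matrix.mul_one,
        Complex.sub_re, Complex.smul_re, smul_eq_mul]
      push_cast at this
      field_simp at this
      field_simp
      linarith
    rw [← sub_eq_zero]
    generalize Mᴴ * M - (m : ℝ)⁻¹ • (1 : Matrix (Fin m) (Fin m) ℂ) = N at h'
    ext j i
    have := h' (Matrix.single ⟨0, Nat.pos_of_ne_zero hn⟩ i 1)
      (Matrix.single ⟨0, Nat.pos_of_ne_zero hn⟩ j (star (N j i)))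
    rw [Matrix.conjTranspose_single, Matrix.single_mul_single_same, Matrix.trace_single_mul] at this
    simp [Complex.mul_re] at this
    have h0 : Complex.normSq (N j i) = 0 := by rw [Complex.normSq_apply]; linarith
    simpa using h0
  · intro h A B
    rw [h, Matrix.mul_smul, Matrix.trace_smul, Matrix.mul_one, Complex.smul_re, smul_eq_mul]
    push_cast
    field_simp
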